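/- arXiv:2404.00542 — 4 statements merged into one kernel-verified Lean document; each statement's English description precedes it below -/
import Mathlib

section
/- Let X and Y be Tychonoff spaces, let E(X) ⊆ C(X) be a QS-algebra on X, and let φ: E_p(X) → E_p(Y) be a uniformly continuous map into a family E(Y) ⊆ C(Y). Then for every y ∈ Y there exist p ∈ ℕ and a finite set K ⊆ X such that |φ(f)(y) − φ(g)(y)| ≤ p whenever f, g ∈ E(X) satisfy |f(x) − g(x)| < 1 for all x ∈ K. -/
open Set Topology TopologicalSpace

/-- A QS-algebra on `X`. -/
def IsQSAlgebra {X : Type*} [TopologicalSpace X] (E : Set (X → ℝ)) : Prop :=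
  (∀ f ∈ E, Continuous f) ∧
  (∀ f ∈ E, ∀ g ∈ E, f + g ∈ E ∧ f * g ∈ E) ∧
  (∀ f ∈ E, ∀ q : ℚ, (q : ℝ) • f ∈ E) ∧
  (∀ x : X, ∀ U ∈ nhds x, ∃ f ∈ E, f x = 1 ∧ ∀ y ∉ U, f y = 0)

/-- Uniform continuity of a map between function spaces with the pointwise topology. -/
def IsUnifContPt {X Y : Type*} (EX : Set (X → ℝ)) (EY : Set (Y → ℝ))
    (φ : EX → EY) : Prop :=
  ∀ U ∈ nhds (0 : Y → ℝ), ∃ V ∈ nhds (0 : X → ℝ),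
    ∀ f g : EX, (f : X → ℝ) - g ∈ V → (φ f : Y → ℝ) - φ g ∈ U

/-- A neighborhood of the zero function in the topology of pointwise convergence contains all
functions that are smaller than `1 / (n + 1)` on some finite set. -/
lemma exists_finite_forall_abs_lt_of_mem_nhds_zero {X : Type*} {V : Set (X → ℝ)}
    (hV : V ∈ nhds (0 : X → ℝ)) :
    ∃ (n : ℕ) (K : Set X), K.Finite ∧
      ∀ h : X → ℝ, (∀ x ∈ K, |h x| < 1 / ((n : ℝ) + 1)) → h ∈ V := by
  rw [nhds_pi, Filter.mem_pi] at hV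
  obtain ⟨K, hK, t, ht, htV⟩ := hV
  have hev : ∀ x ∈ K, ∀ᶠ n : ℕ in Filter.atTop,
      ∀ r : ℝ, |r| < 1 / ((n : ℝ) + 1) → r ∈ t x := by
    intro x _
    obtain ⟨ε, hε, hball⟩ := Metric.mem_nhds_iff.1 (ht x)
    filter_upwards [tendsto_one_div_add_atTop_nhds_zero_nat.eventually_lt_const hε] with n hn r hr
    exact hball (by simpa using hr.trans hn)
  obtain ⟨n, hn⟩ := ((Filter.eventually_all_finite hK).2 hev).exists
  exact ⟨n, K, hK, fun h hh => htV fun x hx => hn x hx _ (hh x hx)⟩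

/-- A QS-algebra contains the points of rational parameter on the line through two members. -/
lemma IsQSAlgebra.add_smul_sub_mem {X : Type*} [TopologicalSpace X] {E : Set (X → ℝ)}
    (hE : IsQSAlgebra E) {f g : X → ℝ} (hf : f ∈ E) (hg : g ∈ E) (q : ℚ) :
    g + (q : ℝ) • (f - g) ∈ E := by
  obtain ⟨-, hadd, hsmul, -⟩ := hE
  have hsub : f - g ∈ E := by
    have h := (hadd f hf _ (hsmul g hg (-1))).1
    simpa [sub_eq_add_neg] using h
  exact (hadd g hg _ (hsmul _ hsub q)).1

theorem statement11 {X Y : Type*} [TopologicalSpace X] [TopologicalSpace Y]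
    [T35Space X] [T35Space Y]
    (EX : Set (X → ℝ)) (hEXqs : IsQSAlgebra EX)
    (EY : Set (Y → ℝ)) (hEYcont : ∀ g ∈ EY, Continuous g)
    (φ : EX → EY) (hφu : IsUnifContPt EX EY φ) :
    ∀ y : Y, ∃ (p : ℕ) (K : Set X), K.Finite ∧
      ∀ f g : EX, (∀ x ∈ K, |(f : X → ℝ) x - (g : X → ℝ) x| < 1) →
        |(φ f : Y → ℝ) y - (φ g : Y → ℝ) y| ≤ (p : ℝ) := by
  intro y
  have hU : {h : Y → ℝ | |h y| < 1} ∈ nhds (0 : Y → ℝ) :=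
    (isOpen_lt (continuous_apply y).abs continuous_const).mem_nhds (by simp)
  obtain ⟨V, hV, hφV⟩ := hφu _ hU
  obtain ⟨n, K, hK, hKV⟩ := exists_finite_forall_abs_lt_of_mem_nhds_zero hV
  refine ⟨n + 1, K, hK, fun f g hfg => ?_⟩
  have hn : (0 : ℝ) < (n : ℝ) + 1 := by positivity
  let c : ℕ → EX := fun i =>
    ⟨_, hEXqs.add_smul_sub_mem f.2 g.2 ((i : ℚ) / ((n : ℚ) + 1))⟩
  have hc : ∀ i x, (c i : X → ℝ) x = (g : X → ℝ) x +
      (i : ℝ) / ((n : ℝ) + 1) * ((f : X → ℝ) x - (g : X → ℝ) x) := by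
    intro i x
    simp [c]
  have hc0 : c 0 = g := Subtype.ext (funext fun x => by simp [hc])
  have hcn : c (n + 1) = f := Subtype.ext (funext fun x => by
    rw [hc]; push_cast; rw [div_self hn.ne']; ring)
  have hstep : ∀ i, |(φ (c (i + 1)) : Y → ℝ) y - (φ (c i) : Y → ℝ) y| ≤ 1 := by
    intro i
    refine le_of_lt (hφV (c (i + 1)) (c i) (hKV _ fun x hx => ?_))
    have hdiff : (c (i + 1) : X → ℝ) x - (c i : X → ℝ) x =
        ((f : X → ℝ) x - (g : X → ℝ) x) / ((n : ℝ) + 1) := by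
      rw [hc, hc]; push_cast; ring
    rw [Pi.sub_apply, hdiff, abs_div, abs_of_pos hn]
    exact div_lt_div_of_pos_right (hfg x hx) hn
  have hchain : ∀ i : ℕ, |(φ (c i) : Y → ℝ) y - (φ (c 0) : Y → ℝ) y| ≤ (i : ℝ) := by
    intro i
    induction i with
    | zero => simp
    | succ i ih =>
      push_cast
      linarith [hstep i, abs_sub_le ((φ (c (i + 1)) : Y → ℝ) y) ((φ (c i) : Y → ℝ) y)
        ((φ (c 0) : Y → ℝ) y)]
  simpa only [hc0, hcn] using hchain (n + 1)
end

section
/- Let 𝒫 be a property of σ-compact metrizable spaces satisfying conditions (a)–(c), and let P be a σ-compact metrizable space all of whose finite powers have the property 𝒫. If a metrizable space Z is the union of countably many compact sets Z_n such that each Z_n admits a continuous map with finite fibers into some finite power P^{k_n} of P, then all finite powers of Z have the property 𝒫. -/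
open Set Topology TopologicalSpace

universe u

/-- The product of finitely many maps into powers of `X`, as a map into one power of `X`. -/
def piFinMap {n : ℕ} {X Y : Type*} {A : Fin n → Set Y} {k : Fin n → ℕ}
    (f : ∀ i, A i → Fin (k i) → X) (x : Set.univ.pi A) : Fin (∑ i, k i) → X :=
  fun j ↦ f (finSigmaFinEquiv.symm j).1 ⟨x.1 _, x.2 _ (Set.mem_univ _)⟩ (finSigmaFinEquiv.symm j).2

theorem continuous_piFinMap {n : ℕ} {X Y : Type*} [TopologicalSpace X] [TopologicalSpace Y]
    {A : Fin n → Set Y} {k : Fin n → ℕ} {f : ∀ i, A i → Fin (k i) → X}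
    (hf : ∀ i, Continuous (f i)) : Continuous (piFinMap f) := by
  refine continuous_pi fun j ↦ (continuous_apply _).comp ((hf _).comp ?_)
  exact ((continuous_apply _).comp continuous_subtype_val).subtype_mk _

theorem finite_preimage_piFinMap {n : ℕ} {X Y : Type*} {A : Fin n → Set Y} {k : Fin n → ℕ}
    {f : ∀ i, A i → Fin (k i) → X} (hf : ∀ i w, (f i ⁻¹' {w}).Finite)
    (w : Fin (∑ i, k i) → X) : (piFinMap f ⁻¹' {w}).Finite := by
  have hfin : (Set.univ.pi fun i ↦
      f i ⁻¹' {fun l ↦ w (finSigmaFinEquiv ⟨i, l⟩)}).Finite :=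
    Set.Finite.pi fun i ↦ hf i _
  let coords : Set.univ.pi A → ∀ i, A i := fun x i ↦ ⟨x.1 i, x.2 i (Set.mem_univ i)⟩
  have hinj : Function.Injective coords := fun x y h ↦
    Subtype.ext (funext fun i ↦ congrArg Subtype.val (congrFun h i))
  refine (hfin.preimage hinj.injOn).subset fun x hx i _ ↦ ?_
  refine funext fun l ↦ ?_
  rw [← show piFinMap f x = w from hx]
  exact congrArg (fun p : (i : Fin n) × Fin (k i) ↦ f p.1 (coords x p.1) p.2)
    (finSigmaFinEquiv.symm_apply_apply ⟨i, l⟩).symm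

theorem statement13
    -- `𝒫` is a property of σ-compact metrizable spaces satisfying (a)-(c)
    (P : ∀ (Z : Type u) [TopologicalSpace Z], Prop)
    (ha : ∀ (Z : Type u) [TopologicalSpace Z] [MetrizableSpace Z] [SigmaCompactSpace Z],
      P Z → ∀ F : Set Z, IsClosed F → P ↥F)
    (hb : ∀ (Z : Type u) [TopologicalSpace Z] [MetrizableSpace Z] [SigmaCompactSpace Z],
      ∀ F : ℕ → Set Z, (∀ n, IsClosed (F n)) → (∀ n, P ↥(F n)) →
        (⋃ n, F n) = Set.univ → P Z)
    (hcc : ∀ (Z W : Type u) [TopologicalSpace Z] [TopologicalSpace W]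
      [MetrizableSpace Z] [SigmaCompactSpace Z] [MetrizableSpace W] [SigmaCompactSpace W],
      ∀ f : Z → W, Continuous f → IsClosedMap f → (∀ w, IsCompact (f ⁻¹' {w})) →
        (∀ w, (f ⁻¹' {w}).Countable) → P W → P Z)
    -- `P` is a σ-compact metrizable space all of whose finite powers have `𝒫`
    (Pspace : Type u) [TopologicalSpace Pspace] [MetrizableSpace Pspace]
    [SigmaCompactSpace Pspace]
    (hP : ∀ n : ℕ, P (Fin n → Pspace))
    -- `Z` is a metrizable space which is the union of countably many compact sets `Z_n`,
    -- each admitting a continuous map with finite fibers into some finite power of `Pspace`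
    (Z : Type u) [TopologicalSpace Z] [MetrizableSpace Z]
    (Zn : ℕ → Set Z) (hZnc : ∀ n, IsCompact (Zn n)) (hZcover : (⋃ n, Zn n) = Set.univ)
    (hmaps : ∀ n : ℕ, ∃ (k : ℕ) (f : ↥(Zn n) → (Fin k → Pspace)),
      Continuous f ∧ ∀ w, (f ⁻¹' {w}).Finite) :
    -- all finite powers of `Z` have the property `𝒫`
    ∀ n : ℕ, P (Fin n → Z) := by
  choose k f hfc hff using hmaps
  have : SigmaCompactSpace Z := ⟨⟨Zn, hZnc, hZcover⟩⟩
  intro n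
  obtain ⟨e, he⟩ := exists_surjective_nat (Fin n → ℕ)
  refine hb _ (fun m ↦ Set.univ.pi fun i ↦ Zn (e m i))
    (fun m ↦ isClosed_set_pi fun i _ ↦ (hZnc _).isClosed) (fun m ↦ ?_) ?_
  · have : CompactSpace (Set.univ.pi fun i ↦ Zn (e m i)) :=
      isCompact_iff_compactSpace.1 (isCompact_univ_pi fun i ↦ hZnc _)
    have hg := continuous_piFinMap fun i ↦ hfc (e m i)
    exact hcc _ _ _ hg hg.isClosedMap
      (fun w ↦ (isClosed_singleton.preimage hg).isCompact)
      (fun w ↦ (finite_preimage_piFinMap (fun i ↦ hff (e m i)) w).countable) (hP _)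
  · refine Set.eq_univ_of_forall fun x ↦ ?_
    have hx : ∀ i, ∃ j, x i ∈ Zn j := fun i ↦
      Set.mem_iUnion.1 (hZcover ▸ Set.mem_univ (x i))
    choose s hs using hx
    obtain ⟨m, rfl⟩ := he s
    exact Set.mem_iUnion.2 ⟨m, fun i _ ↦ hs i⟩
end

section
/- Let X be a Tychonoff space, E(X) ⊆ C(X) a QS-algebra on X, and LE(X) its linear hull with the topology of pointwise convergence. If l: LE_p(X) → ℝ is a continuous linear functional, then there exist finitely many points x_1, …, x_q ∈ X and real numbers λ_1, …, λ_q such that l(f) = Σ_{i=1}^q λ_i f(x_i) for all f ∈ LE(X). -/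
open Set Topology TopologicalSpace

theorem statement15 {X : Type*} [TopologicalSpace X] [T35Space X]
    (E : Set (X → ℝ)) (hE : IsQSAlgebra E)
    -- `LE_p(X)`, the linear hull of `E(X)` with the pointwise topology,
    -- is the span of `E` with the subspace topology of `X → ℝ`
    (l : ↥(Submodule.span ℝ E) →ₗ[ℝ] ℝ) (hl : Continuous l) :
    ∃ (q : ℕ) (x : Fin q → X) (lam : Fin q → ℝ),
      ∀ f : ↥(Submodule.span ℝ E), l f = ∑ i, lam i * (f : X → ℝ) (x i) := by
  have hind : Continuous[⨅ x, induced
      (LinearMap.proj x ∘ₗ (Submodule.span ℝ E).subtype : ↥(Submodule.span ℝ E) →ₗ[ℝ] ℝ)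
      inferInstance, inferInstance] l := by
    convert hl using 1
    exact (induced_to_pi (Subtype.val : ↥(Submodule.span ℝ E) → X → ℝ)).symm
  obtain ⟨q, lam, g, hg⟩ := Submodule.mem_span_set'.mp (l.mem_span_iff_continuous.mpr hind)
  choose x hx using fun i => (g i).2
  refine ⟨q, x, lam, fun f => ?_⟩
  simp [← hg, ← hx]
end

section
/- Let ℕ carry the discrete topology. The map T: C_p(ℕ) → C_p(ℕ) defined by T(f)(n) = f(n)/(n+1) is a continuous linear surjection, but there is no c > 0 for which T is c-good. -/
open Set Topology TopologicalSpace

/-- `T : C_p(ℕ) → C_p(ℕ)`, `T(f)(n) = f(n)/(n+1)`; on the discrete space `ℕ` every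
real-valued function is continuous, so `C_p(ℕ)` is `ℕ → ℝ` with the product topology. -/
noncomputable def Tmap : (ℕ → ℝ) → (ℕ → ℝ) := fun f n => f n / ((n : ℝ) + 1)

noncomputable def supNorm {X : Type*} (f : X → ℝ) : ℝ := ⨆ x, |f x|

theorem statement16 :
    Continuous Tmap ∧ IsLinearMap ℝ Tmap ∧ Function.Surjective Tmap ∧
    ¬ ∃ c : ℝ, 0 < c ∧ ∀ g : ℕ → ℝ, (∃ M, ∀ n, |g n| ≤ M) →
        ∃ f : ℕ → ℝ, Tmap f = g ∧ (∃ M, ∀ n, |f n| ≤ M) ∧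
          supNorm f ≤ c * supNorm g := by
  refine ⟨?_, ⟨fun f g => ?_, fun a f => ?_⟩, fun g => ⟨fun n => g n * ((n : ℝ) + 1), ?_⟩, ?_⟩
  · exact continuous_pi fun n => (continuous_apply n).div_const _
  · funext n
    simp [Tmap, add_div]
  · funext n
    simp [Tmap, mul_div_assoc]
  · funext n
    exact mul_div_cancel_right₀ _ n.cast_add_one_ne_zero
  · rintro ⟨c, -, h⟩
    obtain ⟨f, hf, ⟨M, hM⟩, -⟩ := h (fun _ => 1) ⟨1, by simp⟩
    obtain ⟨n, hn⟩ := exists_nat_gt M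
    have hfn : f n / ((n : ℝ) + 1) = 1 := congrFun hf n
    rw [div_eq_one_iff_eq n.cast_add_one_ne_zero] at hfn
    linarith [le_abs_self (f n), hM n]
end
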